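/- Let N ≥ 1 and let σ be a Hermitian matrix on ℂ² ⊗ ℂ^N. If σ - (Tr(σ)/(2N+2))·𝟙_{2N} is positive semidefinite, then σ is separable. -/

import Mathlib

open Matrix Kronecker
open scoped ComplexOrder

noncomputable section

/-- A Hermitian matrix on ℂ^M ⊗ ℂ^N is separable if it is a finite sum of Kronecker
products of positive semidefinite matrices. -/
def IsSeparableMat {M N : ℕ} (σ : Matrix (Fin M × Fin N) (Fin M × Fin N) ℂ) : Prop :=
  ∃ (k : ℕ) (A : Fin k → Matrix (Fin M) (Fin M) ℂ) (B : Fin k → Matrix (Fin N) (Fin N) ℂ),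
    (∀ i, (A i).PosSemidef) ∧ (∀ i, (B i).PosSemidef) ∧ σ = ∑ i, A i ⊗ₖ B i

/-- Partial transpose on the first (Alice) factor. -/
def ptA {M N : ℕ} (ρ : Matrix (Fin M × Fin N) (Fin M × Fin N) ℂ) :
    Matrix (Fin M × Fin N) (Fin M × Fin N) ℂ :=
  fun p q => ρ (q.1, p.2) (p.1, q.2)

/-- Partial transpose on the second (Bob) factor. -/
def ptB {M N : ℕ} (ρ : Matrix (Fin M × Fin N) (Fin M × Fin N) ℂ) :
    Matrix (Fin M × Fin N) (Fin M × Fin N) ℂ :=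
  fun p q => ρ (p.1, q.2) (q.1, p.2)

/-- The second Pauli matrix σ₂. -/
def pauli2 : Matrix (Fin 2) (Fin 2) ℂ := !![0, -Complex.I; Complex.I, 0]

/-- ρ̃_A = (σ₂ ⊗ 𝟙_N) ρ^{T_A} (σ₂ ⊗ 𝟙_N). -/
def tildeA {N : ℕ} (ρ : Matrix (Fin 2 × Fin N) (Fin 2 × Fin N) ℂ) :
    Matrix (Fin 2 × Fin N) (Fin 2 × Fin N) ℂ :=
  (pauli2 ⊗ₖ (1 : Matrix (Fin N) (Fin N) ℂ)) * ptA ρ *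
    (pauli2 ⊗ₖ (1 : Matrix (Fin N) (Fin N) ℂ))

end

theorem isSeparableMat_kronecker {M N : ℕ} {A : Matrix (Fin M) (Fin M) ℂ}
    {B : Matrix (Fin N) (Fin N) ℂ} (hA : A.PosSemidef) (hB : B.PosSemidef) :
    IsSeparableMat (A ⊗ₖ B) :=
  ⟨1, fun _ => A, fun _ => B, fun _ => hA, fun _ => hB, by simp⟩

theorem isSeparableMat_zero {M N : ℕ} :
    IsSeparableMat (0 : Matrix (Fin M × Fin N) (Fin M × Fin N) ℂ) :=
  ⟨0, fun _ => 0, fun _ => 0, fun _ => .zero, fun _ => .zero, by simp⟩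

theorem IsSeparableMat.add {M N : ℕ} {σ τ : Matrix (Fin M × Fin N) (Fin M × Fin N) ℂ}
    (hσ : IsSeparableMat σ) (hτ : IsSeparableMat τ) : IsSeparableMat (σ + τ) := by
  obtain ⟨k, A, B, hA, hB, rfl⟩ := hσ
  obtain ⟨l, C, D, hC, hD, rfl⟩ := hτ
  refine ⟨k + l, Fin.append A C, Fin.append B D, fun i => ?_, fun i => ?_, ?_⟩
  · refine Fin.addCases (fun i => ?_) (fun i => ?_) i
    · simpa using hA i
    · simpa using hC i
  · refine Fin.addCases (fun i => ?_) (fun i => ?_) i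
    · simpa using hB i
    · simpa using hD i
  · simp [Fin.sum_univ_add]

theorem isSeparableMat_sum {M N : ℕ} {ι : Type*} (s : Finset ι)
    (f : ι → Matrix (Fin M × Fin N) (Fin M × Fin N) ℂ) (hf : ∀ i ∈ s, IsSeparableMat (f i)) :
    IsSeparableMat (∑ i ∈ s, f i) :=
  Finset.sum_induction f IsSeparableMat (fun _ _ => IsSeparableMat.add) isSeparableMat_zero hf

/-- The matrix form of the Cauchy-Schwarz inequality. -/
theorem posSemidef_sum_normSq_smul_one_sub_vecMulVec {n : Type*} [Fintype n] [DecidableEq n]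
    (w : n → ℂ) :
    (((∑ j, Complex.normSq (w j) : ℝ) : ℂ) • (1 : Matrix n n ℂ) -
      vecMulVec w (star w)).PosSemidef := by
  have hdot : ∀ y : n → ℂ, star y ⬝ᵥ y = ((‖WithLp.toLp 2 y‖ ^ 2 : ℝ) : ℂ) := fun y => by
    rw [dotProduct_comm, ← EuclideanSpace.inner_toLp_toLp, inner_self_eq_norm_sq_to_K]
    norm_cast
  have hw : ((∑ j, Complex.normSq (w j) : ℝ) : ℂ) = ((‖WithLp.toLp 2 w‖ ^ 2 : ℝ) : ℂ) := by
    rw [EuclideanSpace.norm_sq_eq]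
    simp [Complex.normSq_eq_norm_sq]
  refine .of_dotProduct_mulVec_nonneg ?_ fun x => ?_
  · refine IsHermitian.sub ?_ (posSemidef_vecMulVec_self_star w).1
    simp [IsHermitian]
  · have hinner : star x ⬝ᵥ w = inner ℂ (WithLp.toLp 2 x) (WithLp.toLp 2 w) := by
      rw [EuclideanSpace.inner_toLp_toLp, dotProduct_comm]
    have hconj : star w ⬝ᵥ x = star (star x ⬝ᵥ w) := by
      rw [star_dotProduct]
    have hcs := norm_inner_le_norm (𝕜 := ℂ) (WithLp.toLp 2 x) (WithLp.toLp 2 w)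
    have key : star x ⬝ᵥ ((((∑ j, Complex.normSq (w j) : ℝ) : ℂ) • (1 : Matrix n n ℂ) -
        vecMulVec w (star w)) *ᵥ x) =
        (((‖WithLp.toLp 2 x‖ * ‖WithLp.toLp 2 w‖) ^ 2 -
          ‖inner ℂ (WithLp.toLp 2 x) (WithLp.toLp 2 w)‖ ^ 2 : ℝ) : ℂ) := by
      have hz : (star x ⬝ᵥ w) * (star w ⬝ᵥ x) = ((‖star x ⬝ᵥ w‖ ^ 2 : ℝ) : ℂ) := by
        rw [hconj, Complex.star_def, Complex.mul_conj, Complex.normSq_eq_norm_sq]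
      rw [sub_mulVec, dotProduct_sub, smul_mulVec, one_mulVec, dotProduct_smul, hdot, hw,
        vecMulVec_mulVec, ← hinner]
      simp only [op_smul_eq_smul, dotProduct_smul, smul_eq_mul]
      rw [mul_comm (star w ⬝ᵥ x), hz]
      push_cast
      ring
    rw [key]
    exact_mod_cast sub_nonneg.mpr (pow_le_pow_left₀ (norm_nonneg _) hcs 2)

theorem exists_rotation_sum_normSq_eq {n : Type*} [Fintype n] (x y : n → ℂ) :
    ∃ c s : ℝ, c ^ 2 + s ^ 2 = 1 ∧
      ∑ j, Complex.normSq (c * x j + s * y j) =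
        (∑ j, Complex.normSq (x j) + ∑ j, Complex.normSq (y j)) / 2 ∧
      ∑ j, Complex.normSq (c * y j - s * x j) =
        (∑ j, Complex.normSq (x j) + ∑ j, Complex.normSq (y j)) / 2 := by
  let F : ℝ → ℝ := fun θ =>
    ∑ j, Complex.normSq ((Real.cos θ : ℂ) * x j + (Real.sin θ : ℂ) * y j)
  have hF : Continuous F := by
    refine continuous_finsetSum _ fun j _ => Complex.continuous_normSq.comp ?_
    exact ((Complex.continuous_ofReal.comp Real.continuous_cos).mul continuous_const).add
      ((Complex.continuous_ofReal.comp Real.continuous_sin).mul continuous_const)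
  have h0 : F 0 = ∑ j, Complex.normSq (x j) := by simp [F]
  have h1 : F (Real.pi / 2) = ∑ j, Complex.normSq (y j) := by
    simp only [F, Real.cos_pi_div_two, Real.sin_pi_div_two]
    simp
  have hmem : (F 0 + F (Real.pi / 2)) / 2 ∈ Set.uIcc (F 0) (F (Real.pi / 2)) := by
    rw [Set.mem_uIcc]
    rcases le_total (F 0) (F (Real.pi / 2)) with h | h
    · left; constructor <;> linarith
    · right; constructor <;> linarith
  obtain ⟨θ, -, hθ⟩ := intermediate_value_uIcc hF.continuousOn hmem
  rw [h0, h1] at hθ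
  have hcs := Real.cos_sq_add_sin_sq θ
  refine ⟨Real.cos θ, Real.sin θ, hcs, hθ, ?_⟩
  have hsum : F θ + ∑ j, Complex.normSq ((Real.cos θ : ℂ) * y j - (Real.sin θ : ℂ) * x j) =
      ∑ j, Complex.normSq (x j) + ∑ j, Complex.normSq (y j) := by
    simp only [F, ← Finset.sum_add_distrib]
    refine Finset.sum_congr rfl fun j _ => ?_
    simp only [Complex.normSq_apply, Complex.add_re, Complex.add_im, Complex.sub_re,
      Complex.sub_im, Complex.mul_re, Complex.mul_im, Complex.ofReal_re, Complex.ofReal_im]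
    linear_combination
      ((x j).re ^ 2 + (x j).im ^ 2 + (y j).re ^ 2 + (y j).im ^ 2) * hcs
  linarith

theorem fourthRoots_average (a b a' b' p q p' q' : ℂ) :
    (a + b) * (a' + b') * (1 / 4 * ((p + q) * (p' + q'))) +
      ((a - b) * (a' - b') * (1 / 4 * ((p - q) * (p' - q'))) +
      ((a + Complex.I * b) * (a' - Complex.I * b') *
        (1 / 4 * ((p - Complex.I * q) * (p' + Complex.I * q'))) +
      (a - Complex.I * b) * (a' + Complex.I * b') *
        (1 / 4 * ((p + Complex.I * q) * (p' - Complex.I * q'))))) =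
    (a * a' + b * b') * (p * p' + q * q') + a * b' * (p * q') + b * a' * (q * p') := by
  have h : ∀ z w z' w' : ℂ, (z + Complex.I * w) * (z' - Complex.I * w') =
      z * z' + w * w' + Complex.I * (w * z' - z * w') := fun z w z' w' => by
    linear_combination -(w * w') * Complex.I_sq
  have h' : ∀ z w z' w' : ℂ, (z - Complex.I * w) * (z' + Complex.I * w') =
      z * z' + w * w' - Complex.I * (w * z' - z * w') := fun z w z' w' => by
    linear_combination -(w * w') * Complex.I_sq
  rw [h, h', h, h']
  linear_combination (-1 / 2 * (b * a' - a * b') * (q * p' - p * q')) * Complex.I_sq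

/-- The product decomposition comes from rotating the first factor so that both blocks of `v`
have the same norm, and averaging over the fourth roots of unity. -/
theorem isSeparableMat_smul_one_add_vecMulVec {N : ℕ} (v : Fin 2 × Fin N → ℂ) :
    IsSeparableMat ((((∑ p, Complex.normSq (v p)) / 2 : ℝ) : ℂ) •
      (1 : Matrix (Fin 2 × Fin N) (Fin 2 × Fin N) ℂ) + vecMulVec v (star v)) := by
  obtain ⟨c, s, hcs, hx, hy⟩ :=
    exists_rotation_sum_normSq_eq (fun j => v (0, j)) (fun j => v (1, j))
  have hn : ∑ p, Complex.normSq (v p) =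
      ∑ j, Complex.normSq (v (0, j)) + ∑ j, Complex.normSq (v (1, j)) := by
    rw [Fintype.sum_prod_type, Fin.sum_univ_two]
  rw [← hn] at hx hy
  set r : ℝ := (∑ p, Complex.normSq (v p)) / 2 with hr
  set x : Fin N → ℂ := fun j => c * v (0, j) + s * v (1, j) with hxdef
  set y : Fin N → ℂ := fun j => c * v (1, j) - s * v (0, j) with hydef
  let e : Fin 2 → ℂ := ![c, s]
  let f : Fin 2 → ℂ := ![-s, c]
  have hX := posSemidef_sum_normSq_smul_one_sub_vecMulVec x
  have hY := posSemidef_sum_normSq_smul_one_sub_vecMulVec y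
  rw [hx] at hX
  rw [hy] at hY
  have hquarter : (0 : ℂ) ≤ 1 / 4 := by
    rw [show (1 / 4 : ℂ) = ((1 / 4 : ℝ) : ℂ) by norm_num]
    exact_mod_cast (by norm_num : (0 : ℝ) ≤ 1 / 4)
  let T : ℂ → Matrix (Fin 2 × Fin N) (Fin 2 × Fin N) ℂ := fun ω =>
    vecMulVec (e + ω • f) (star (e + ω • f)) ⊗ₖ
      ((1 / 4 : ℂ) • vecMulVec (x + star ω • y) (star (x + star ω • y)))
  have hT : ∀ ω, IsSeparableMat (T ω) := fun ω =>
    isSeparableMat_kronecker (posSemidef_vecMulVec_self_star _)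
      ((posSemidef_vecMulVec_self_star _).smul hquarter)
  have hE := isSeparableMat_kronecker (posSemidef_vecMulVec_self_star e) hY
  have hF := isSeparableMat_kronecker (posSemidef_vecMulVec_self_star f) hX
  convert hE.add (hF.add ((hT 1).add ((hT (-1)).add ((hT Complex.I).add (hT (-Complex.I))))))
    using 1
  have hcs' : (c : ℂ) ^ 2 + (s : ℂ) ^ 2 = 1 := by exact_mod_cast hcs
  have hv0 : ∀ j, v (0, j) = c * x j - s * y j := fun j => by
    simp only [hxdef, hydef]
    linear_combination -v (0, j) * hcs'
  have hv1 : ∀ j, v (1, j) = s * x j + c * y j := fun j => by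
    simp only [hxdef, hydef]
    linear_combination -v (1, j) * hcs'
  have he : ∀ a, starRingEnd ℂ (e a) = e a := fun a => by fin_cases a <;> simp [e]
  have hf : ∀ a, starRingEnd ℂ (f a) = f a := fun a => by fin_cases a <;> simp [f]
  have hv : ∀ a j, v (a, j) = e a * x j + f a * y j := fun a j => by
    fin_cases a
    · simpa [e, f, sub_eq_add_neg] using hv0 j
    · simpa [e, f] using hv1 j
  have hone : ∀ a b, (1 : Matrix (Fin 2) (Fin 2) ℂ) a b = e a * e b + f a * f b := fun a b => by
    fin_cases a <;> fin_cases b <;> simp [e, f] <;> first | linear_combination -hcs' | ring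
  clear_value x y r e f
  ext ⟨a, i⟩ ⟨b, k⟩
  have havg := fourthRoots_average (e a) (f a) (e b) (f b) (x i) (y i) (star (x k)) (star (y k))
  rw [← one_kronecker_one]
  simp only [T, Matrix.add_apply, Matrix.sub_apply, Matrix.smul_apply, kroneckerMap_apply,
    vecMulVec_apply, Pi.star_apply, Pi.add_apply, Pi.smul_apply, smul_eq_mul, Complex.star_def, map_add,
    map_mul, map_neg, map_one, he, hf, hv, hone, Complex.conj_I, one_mul,
    neg_mul, neg_neg] at havg ⊢
  linear_combination -havg

theorem stmt2 {N : ℕ} (hN : 1 ≤ N)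
    (σ : Matrix (Fin 2 × Fin N) (Fin 2 × Fin N) ℂ) (hσ : σ.IsHermitian)
    (hpos : (σ - (σ.trace / ((2 * (N : ℝ) + 2 : ℝ) : ℂ)) •
        (1 : Matrix (Fin 2 × Fin N) (Fin 2 × Fin N) ℂ)).PosSemidef) :
    IsSeparableMat σ := by
  obtain ⟨m, v, hv⟩ := posSemidef_iff_eq_sum_vecMulVec.mp hpos
  have hd : ((2 * (N : ℝ) + 2 : ℝ) : ℂ) ≠ 0 := by
    exact_mod_cast (by positivity : (2 * (N : ℝ) + 2) ≠ 0)
  have htr : ((∑ i, (∑ p, Complex.normSq (v i p)) / 2 : ℝ) : ℂ) =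
      σ.trace / ((2 * (N : ℝ) + 2 : ℝ) : ℂ) := by
    have h := congrArg trace hv
    rw [trace_sub, trace_smul, trace_one, trace_sum] at h
    have hi : ∀ i, (vecMulVec (v i) (star (v i))).trace =
        ((∑ p, Complex.normSq (v i p) : ℝ) : ℂ) := fun i => by
      simp [trace, vecMulVec_apply, Complex.mul_conj]
    simp only [hi, Fintype.card_prod, Fintype.card_fin, smul_eq_mul] at h
    rw [← Finset.sum_div, Complex.ofReal_div, Complex.ofReal_sum, ← h]
    field_simp
    push_cast
    ring
  have hdecomp : σ = ∑ i, ((((∑ p, Complex.normSq (v i p)) / 2 : ℝ) : ℂ) •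
      (1 : Matrix (Fin 2 × Fin N) (Fin 2 × Fin N) ℂ) + vecMulVec (v i) (star (v i))) := by
    rw [Finset.sum_add_distrib, ← Finset.sum_smul, ← Complex.ofReal_sum, htr, ← hv]
    abel
  rw [hdecomp]
  exact isSeparableMat_sum _ _ fun i _ => isSeparableMat_smul_one_add_vecMulVec (v i)
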